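/- Let μ > π/2 and set ν := π/(2μ). Define D_μ := {(z₁,z₂,z₃) ∈ ℂ³ : z₂ ≠ 0, z₃ ≠ 0, Re(z₁·exp(−i·log|z₂z₃|²)) > 0, −μ < log|z₂|² < μ, −μ < log|z₃|² < μ}, and for z, z' ∈ D_μ define K(z,z') := (z₂·conj(z₂')·z₃·conj(z₃'))⁻¹ · ∫_ℝ ξ³·E_{iξ−1}(z)·conj(E_{iξ−1}(z')) / (2π³·sinh²(2μξ)·sinh(πξ)) dξ. Fix z' ∈ D_μ, m ∈ ℕ and s ∈ [0,1) with m − s ≥ ν. Then the function z ↦ (Re(z₁·exp(−i·log|z₂z₃|²)))^s · D₁^m K(z,z'), where D₁^m denotes the m-th iterated complex derivative of the holomorphic function z₁ ↦ K((z₁,z₂,z₃), z'), is not square-integrable on D_μ with respect to Lebesgue measure on ℂ³. -/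

import Mathlib

open Complex MeasureTheory ComplexConjugate

/-- `log|z₂z₃|²` as a real number. -/
noncomputable def Lofz (z : ℂ × ℂ × ℂ) : ℝ :=
  Real.log (‖z.2.1 * z.2.2‖ ^ 2)

/-- The model worm `D_μ`. -/
noncomputable def Dmod (μ : ℝ) : Set (ℂ × ℂ × ℂ) :=
  {z | z.2.1 ≠ 0 ∧ z.2.2 ≠ 0 ∧
    0 < (z.1 * Complex.exp (-(Complex.I * (Lofz z : ℂ)))).re ∧
    -μ < Real.log (‖z.2.1‖ ^ 2) ∧ Real.log (‖z.2.1‖ ^ 2) < μ ∧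
    -μ < Real.log (‖z.2.2‖ ^ 2) ∧ Real.log (‖z.2.2‖ ^ 2) < μ}

/-- The holomorphic logarithm `ℓ`, defined via the principal branch `Log`. -/
noncomputable def ellfun (z : ℂ × ℂ × ℂ) : ℂ :=
  Complex.log (z.1 * Complex.exp (-(Complex.I * (Lofz z : ℂ)))) + Complex.I * (Lofz z : ℂ)

/-- The holomorphic power `E_κ = exp(κℓ)`. -/
noncomputable def Efun (κ : ℂ) (z : ℂ × ℂ × ℂ) : ℂ :=
  Complex.exp (κ * ellfun z)

/-- The reproducing kernel `K = K_{−1,−1}` of the subspace `H^{−1,−1}(D_μ)` of the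
Bergman space of `D_μ`. -/
noncomputable def Kker (μ : ℝ) (z z' : ℂ × ℂ × ℂ) : ℂ :=
  (z.2.1 * conj z'.2.1 * z.2.2 * conj z'.2.2)⁻¹ *
    ∫ ξ : ℝ, ((ξ : ℂ) ^ 3 * Efun (Complex.I * (ξ : ℂ) - 1) z *
        conj (Efun (Complex.I * (ξ : ℂ) - 1) z')) /
      (2 * (Real.pi : ℂ) ^ 3 * Complex.sinh (2 * (μ : ℂ) * (ξ : ℂ)) ^ 2 *
        Complex.sinh ((Real.pi : ℂ) * (ξ : ℂ)))


open FourierTransform in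
lemma plancherel_aux (f : ℝ → ℂ) (h1 : Integrable f) (h2 : MemLp f 2) :
    ∫⁻ t, ‖𝓕 f t‖ₑ ^ 2 = ∫⁻ x, ‖f x‖ₑ ^ 2 := by
  set F : Lp (α := ℝ) ℂ 2 := h2.toLp f with hF
  have hcont : Continuous (𝓕 f) := by
    exact VectorFourier.fourierIntegral_continuous Real.continuous_fourierChar
      (L := innerₗ ℝ) continuous_inner h1
  have key : ∀ᵐ t, (𝓕 F : Lp (α := ℝ) ℂ 2 volume) t = 𝓕 f t := by
    apply ae_eq_of_integral_contDiff_smul_eq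
    · exact (Lp.memLp _).locallyIntegrable (by norm_num)
    · exact hcont.locallyIntegrable
    · intro g hg hgs
      have hg1 : HasCompactSupport (fun x => (g x : ℂ)) := hgs.comp_left (g := fun x : ℝ => (x : ℂ)) (by simp)
      have hg2 : ContDiff ℝ ((⊤ : ℕ∞) : WithTop ℕ∞) (fun x => (g x : ℂ)) := Complex.ofRealCLM.contDiff.comp hg
      set S : SchwartzMap ℝ ℂ := hg1.toSchwartzMap hg2 with hS
      have hSx : ∀ x, S x = (g x : ℂ) := fun x => by simp [S]
      have e1 := congrArg (fun T => T S) (Lp.fourier_toTemperedDistribution_eq F)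
      simp only [TemperedDistribution.fourier_apply, Lp.toTemperedDistribution_apply] at e1
      have e2 : ∫ x, (𝓕 S) x • F x = ∫ x, (𝓕 S) x • f x := by
        apply integral_congr_ae
        filter_upwards [h2.coeFn_toLp] with x hx
        rw [hF, hx]
      have e3 : ∫ x, (𝓕 S) x • f x = ∫ x, S x • 𝓕 f x := by
        have := VectorFourier.integral_fourierIntegral_smul_eq_flip (L := innerₗ ℝ) (μ := volume) (ν := volume) (f := S) (g := f)
          Real.continuous_fourierChar continuous_inner S.integrable h1
        simpa using! this
      rw [e2, e3] at e1
      simp only [hSx] at e1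
      simpa using e1.symm
  have hn : eLpNorm (𝓕 F : Lp (α := ℝ) ℂ 2 volume) 2 volume = eLpNorm F 2 volume := by
    have := Lp.norm_fourier_eq F
    rw [Lp.norm_def, Lp.norm_def] at this
    exact (ENNReal.toReal_eq_toReal_iff' (Lp.eLpNorm_ne_top _) (Lp.eLpNorm_ne_top _)).1 this
  rw [eLpNorm_congr_ae key, eLpNorm_congr_ae h2.coeFn_toLp] at hn
  have e : ∀ u : ℝ → ℂ, eLpNorm u 2 volume ^ 2 = ∫⁻ x, ‖u x‖ₑ ^ 2 := by
    intro u
    have := eLpNorm_nnreal_pow_eq_lintegral (f := u) (μ := (volume : Measure ℝ)) (p := 2) (by norm_num)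
    simpa using this
  rw [← e, ← e, hn]

lemma integrable_exp_abs (c : ℝ) (hc : 0 < c) :
    Integrable (fun x : ℝ => Real.exp (-c * |x|)) := by
  have h1 : IntegrableOn (fun x : ℝ => Real.exp (-c * |x|)) (Set.Ioi 0) :=
    (integrableOn_exp_mul_Ioi (by linarith : -c < 0) 0).congr_fun
      (fun x hx => by simp only [abs_of_pos (Set.mem_Ioi.1 hx)]) measurableSet_Ioi
  have h2 : IntegrableOn (fun x : ℝ => Real.exp (-c * |x|)) (Set.Iic 0) :=
    (integrableOn_exp_mul_Iic hc 0).congr_fun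
      (fun x hx => by simp only [abs_of_nonpos (Set.mem_Iic.1 hx)]; ring_nf) measurableSet_Iic
  rw [← integrableOn_univ, ← Set.Iic_union_Ioi (a := (0:ℝ))]
  exact h2.union h1

lemma contour_shift (f : ℂ → ℂ) (σ C c : ℝ) (hσ : 0 ≤ σ) (hc : 0 < c)
    (hd : ∀ x y : ℝ, -σ ≤ y → y ≤ 0 → DifferentiableAt ℂ f (x + y * I))
    (hb : ∀ x y : ℝ, -σ ≤ y → y ≤ 0 → ‖f (x + y * I)‖ ≤ C * Real.exp (-c * |x|)) :
    ∫ x : ℝ, f x = ∫ x : ℝ, f (x - σ * I) := by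
  have hint : Integrable (fun x : ℝ => C * Real.exp (-c * |x|)) := by
    exact (integrable_exp_abs c hc).const_mul C
  have hline : ∀ y : ℝ, -σ ≤ y → y ≤ 0 → Integrable (fun x : ℝ => f (x + y * I)) := by
    intro y h1 h2
    apply hint.mono'
    · apply Continuous.aestronglyMeasurable
      rw [continuous_iff_continuousAt]
      intro x
      have := (hd x y h1 h2).continuousAt
      exact ContinuousAt.comp (f := fun x : ℝ => (x : ℂ) + y * I) this (by fun_prop)
    · exact Filter.Eventually.of_forall (fun x => hb x y h1 h2)
  have l0 := intervalIntegral_tendsto_integral (hline 0 (by linarith) le_rfl)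
    Filter.tendsto_neg_atTop_atBot Filter.tendsto_id
  have l1 := intervalIntegral_tendsto_integral (hline (-σ) le_rfl (by linarith))
    Filter.tendsto_neg_atTop_atBot Filter.tendsto_id
  have dec : Filter.Tendsto (fun R : ℝ => C * Real.exp (-c * |R|) * σ) Filter.atTop (nhds 0) := by
    have : Filter.Tendsto (fun R : ℝ => Real.exp (-c * |R|)) Filter.atTop (nhds 0) := by
      apply Real.tendsto_exp_atBot.comp
      apply Filter.Tendsto.const_mul_atTop_of_neg (by linarith)
      exact Filter.tendsto_abs_atTop_atTop
    simpa using (this.const_mul C).mul_const σ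
  have side : ∀ R : ℝ, ‖∫ y : ℝ in (-σ)..0, f (R + y * I)‖ ≤ C * Real.exp (-c * |R|) * σ := by
    intro R
    have := intervalIntegral.norm_integral_le_of_norm_le_const (a := -σ) (b := 0)
      (f := fun y : ℝ => f (R + y * I)) (C := C * Real.exp (-c * |R|)) (by
        intro y hy
        rw [Set.uIoc_of_le (by linarith)] at hy
        exact hb R y hy.1.le hy.2)
    simpa [abs_of_nonneg hσ] using this
  have s1 : Filter.Tendsto (fun R : ℝ => ∫ y : ℝ in (-σ)..0, f (R + y * I)) Filter.atTop (nhds 0) :=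
    squeeze_zero_norm side dec
  have s2 : Filter.Tendsto (fun R : ℝ => ∫ y : ℝ in (-σ)..0, f (((-R : ℝ) : ℂ) + y * I)) Filter.atTop (nhds 0) :=
    squeeze_zero_norm (fun R => by simpa using side (-R)) dec
  have rect : ∀ R : ℝ, (∫ x : ℝ in -R..R, f (x + (-σ : ℝ) * I)) - (∫ x : ℝ in -R..R, f (x + (0:ℝ) * I)) +
      I • (∫ y : ℝ in (-σ)..0, f (R + y * I)) -
      I • (∫ y : ℝ in (-σ)..0, f (((-R : ℝ) : ℂ) + y * I)) = 0 := by
    intro R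
    have := integral_boundary_rect_eq_zero_of_differentiableOn f ⟨-R, -σ⟩ ⟨R, 0⟩ (by
      intro z hz
      rw [mem_reProdIm] at hz
      simp only [Set.uIcc_of_le (show -σ ≤ 0 by linarith)] at hz
      have := hd z.re z.im hz.2.1 hz.2.2
      rw [re_add_im] at this
      exact this.differentiableWithinAt)
    exact this
  have lim := ((l1.sub l0).add (s1.const_smul I)).sub (s2.const_smul I)
  have lim2 := lim.congr rect
  have := tendsto_nhds_unique lim2 tendsto_const_nhds
  simp only [smul_zero, add_zero, sub_zero] at this
  have h := sub_eq_zero.1 this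
  simp only [ofReal_zero, zero_mul, add_zero, ofReal_neg, neg_mul] at h
  simp only [sub_eq_add_neg]
  exact h.symm


open FourierTransform in
lemma not_L2_core (h : ℂ → ℂ) (ν b θ : ℝ) (hν : 0 < ν) (hθ : |θ| < b)
    (hd : ∀ ξ : ℂ, -ν < ξ.im → ξ.im ≤ 0 → DifferentiableAt ℂ h ξ)
    (hb : ∀ σ : ℝ, 0 ≤ σ → σ < ν → ∃ C, ∀ x y : ℝ, -σ ≤ y → y ≤ 0 →
      ‖h (x + y * I)‖ ≤ C * Real.exp (-b * |x|))
    (hp : ∃ c > 0, ∃ ε > 0, ∀ ξ : ℂ, -ν < ξ.im → ‖ξ + ν * I‖ < ε → c ≤ ‖h ξ‖ * ‖ξ + ν * I‖)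
    (hfin : ∫⁻ τ in Set.Ioi (0:ℝ), ‖∫ x : ℝ, h x * cexp (-(θ * x)) *
        cexp (-(2 * Real.pi * x * τ * I))‖ₑ ^ 2 *
        ENNReal.ofReal (Real.exp (4 * Real.pi * ν * τ)) < ⊤) : False := by
  set f : ℝ → ℝ → ℂ := fun σ x => h (x - σ * I) * cexp (-(θ * (x - σ * I))) with hf
  have hF : ∀ (σ τ : ℝ), 𝓕 (f σ) τ = ∫ x : ℝ, f σ x * cexp (-(2 * Real.pi * x * τ * I)) := by
    intro σ τ
    rw [Real.fourier_eq']
    congr 1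
    ext x
    simp only [smul_eq_mul]
    rw [mul_comm]
    congr 2
    simp
    ring
  have hbf : ∀ σ : ℝ, 0 ≤ σ → σ < ν → ∃ C, ∀ x : ℝ, ‖f σ x‖ ≤ C * Real.exp (-(b - |θ|) * |x|) := by
    intro σ h0 h1
    obtain ⟨C, hC⟩ := hb σ h0 h1
    refine ⟨C, fun x => ?_⟩
    have e1 := hC x (-σ) le_rfl (by linarith)
    have e2 : ‖cexp (-(θ * (x - σ * I)))‖ ≤ Real.exp (|θ| * |x|) := by
      rw [norm_exp]
      simp
      rw [← abs_mul]
      exact neg_le_abs _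
    have e3 : (x : ℂ) + ((-σ : ℝ) : ℂ) * I = x - σ * I := by push_cast; ring
    rw [e3] at e1
    calc ‖f σ x‖ = ‖h (x - σ * I)‖ * ‖cexp (-(θ * (x - σ * I)))‖ := norm_mul _ _
      _ ≤ (C * Real.exp (-b * |x|)) * Real.exp (|θ| * |x|) := by
        apply mul_le_mul e1 e2 (norm_nonneg _) (le_trans (norm_nonneg _) e1)
      _ = _ := by rw [mul_assoc, ← Real.exp_add]; ring_nf
  have hcf : ∀ σ : ℝ, 0 ≤ σ → σ < ν → Continuous (f σ) := by
    intro σ h0 h1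
    rw [continuous_iff_continuousAt]
    intro x
    have := (hd (x - σ * I) (by simp; linarith) (by simp; linarith)).continuousAt
    have h2 : ContinuousAt (fun x : ℝ => h (x - σ * I)) x :=
      ContinuousAt.comp (f := fun x : ℝ => (x : ℂ) - σ * I) this (by fun_prop)
    exact h2.mul (by fun_prop)
  have hL1 : ∀ σ : ℝ, 0 ≤ σ → σ < ν → Integrable (f σ) := by
    intro σ h0 h1
    obtain ⟨C, hC⟩ := hbf σ h0 h1
    exact ((integrable_exp_abs (b - |θ|) (by linarith)).const_mul C).mono'
      (hcf σ h0 h1).aestronglyMeasurable (Filter.Eventually.of_forall hC)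
  have hL2 : ∀ σ : ℝ, 0 ≤ σ → σ < ν → MemLp (f σ) 2 := by
    intro σ h0 h1
    obtain ⟨C, hC⟩ := hbf σ h0 h1
    rw [memLp_two_iff_integrable_sq_norm (hcf σ h0 h1).aestronglyMeasurable]
    refine ((integrable_exp_abs (2 * (b - |θ|)) (by linarith)).const_mul (C ^ 2)).mono'
      ((hcf σ h0 h1).norm.pow 2).aestronglyMeasurable (Filter.Eventually.of_forall fun x => ?_)
    rw [Real.norm_of_nonneg (by positivity)]
    calc ‖f σ x‖ ^ 2 ≤ (C * Real.exp (-(b - |θ|) * |x|)) ^ 2 := by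
          gcongr
          exact hC x
      _ = _ := by rw [mul_pow, ← Real.exp_nat_mul]; ring_nf
  have hPl : ∀ σ : ℝ, 0 ≤ σ → σ < ν → ∫⁻ t, ‖𝓕 (f σ) t‖ₑ ^ 2 = ∫⁻ x, ‖f σ x‖ₑ ^ 2 :=
    fun σ h0 h1 => plancherel_aux _ (hL1 σ h0 h1) (hL2 σ h0 h1)
  have hshift : ∀ σ : ℝ, 0 ≤ σ → σ < ν → ∀ τ : ℝ,
      𝓕 (f 0) τ = Real.exp (-(2 * Real.pi * σ * τ)) * 𝓕 (f σ) τ := by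
    intro σ h0 h1 τ
    obtain ⟨C, hC⟩ := hb σ h0 h1
    set Φ : ℂ → ℂ := fun ξ => h ξ * cexp (-(θ * ξ)) * cexp (-(2 * Real.pi * ξ * τ * I)) with hΦ
    have := contour_shift Φ σ (C * Real.exp (2 * Real.pi * σ * |τ|)) (b - |θ|) h0 (by linarith) (by
      intro x y hy1 hy2
      have := hd (x + y * I) (by simp; linarith) (by simpa using hy2)
      fun_prop) (by
      intro x y hy1 hy2
      have e1 := hC x y hy1 hy2
      have e2 : ‖cexp (-(θ * (x + y * I)))‖ ≤ Real.exp (|θ| * |x|) := by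
        rw [norm_exp]
        simp
        rw [← abs_mul]
        exact neg_le_abs _
      have e3 : ‖cexp (-(2 * Real.pi * (x + y * I) * τ * I))‖ ≤ Real.exp (2 * Real.pi * σ * |τ|) := by
        rw [norm_exp]
        apply Real.exp_le_exp.2
        simp
        have : y * τ ≤ σ * |τ| := by
          calc y * τ ≤ |y * τ| := le_abs_self _
            _ = |y| * |τ| := abs_mul _ _
            _ ≤ σ * |τ| := by
              gcongr
              rw [abs_le]; constructor <;> linarith
        nlinarith [Real.pi_pos]
      calc ‖Φ (x + y * I)‖ = ‖h (x + y * I)‖ * ‖cexp (-(θ * (x + y * I)))‖ *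
            ‖cexp (-(2 * Real.pi * (x + y * I) * τ * I))‖ := by
            simp only [hΦ, norm_mul]
        _ ≤ (C * Real.exp (-b * |x|)) * Real.exp (|θ| * |x|) * Real.exp (2 * Real.pi * σ * |τ|) := by
          have : 0 ≤ C * Real.exp (-b * |x|) := le_trans (norm_nonneg _) e1
          gcongr
        _ = _ := by
          have : Real.exp (-(b - |θ|) * |x|) = Real.exp (-b * |x|) * Real.exp (|θ| * |x|) := by
            rw [← Real.exp_add]; ring_nf
          rw [this]; ring)
    rw [hF, hF]
    have e0 : ∫ x : ℝ, f 0 x * cexp (-(2 * Real.pi * x * τ * I)) = ∫ x : ℝ, Φ x := by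
      simp [hf, hΦ]
    rw [e0, this, ← integral_const_mul]
    congr 1
    ext x
    simp only [hΦ, hf]
    have : cexp (-(2 * Real.pi * (x - σ * I) * τ * I)) =
      ((Real.exp (-(2 * Real.pi * σ * τ)) : ℝ) : ℂ) * cexp (-(2 * Real.pi * x * τ * I)) := by
      rw [ofReal_exp, ← Complex.exp_add]
      congr 1
      push_cast
      ring_nf
      rw [I_sq]; ring
    rw [this]; ring
  obtain ⟨c, hc, ε, hε, hlow⟩ := hp
  set M : ENNReal := (∫⁻ τ in Set.Ioi (0:ℝ), ‖𝓕 (f 0) τ‖ₑ ^ 2 *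
        ENNReal.ofReal (Real.exp (4 * Real.pi * ν * τ))) + ∫⁻ x, ‖f 0 x‖ₑ ^ 2 with hM
  have hMfin : M ≠ ⊤ := by
    rw [hM]
    apply ENNReal.add_ne_top.2
    constructor
    · simp only [hF]
      simp only [hf, ofReal_zero, zero_mul, sub_zero]
      exact hfin.ne
    · have := (hL2 0 le_rfl hν)
      have h2 := (memLp_two_iff_integrable_sq_norm (hcf 0 le_rfl hν).aestronglyMeasurable).1 this
      have h3 := h2.2.ne
      simpa using h3
  have hupper : ∀ σ : ℝ, 0 ≤ σ → σ < ν → ∫⁻ x, ‖f σ x‖ₑ ^ 2 ≤ M := by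
    intro σ h0 h1
    rw [← hPl σ h0 h1, ← lintegral_add_compl _ (measurableSet_Ioi (a := (0:ℝ)))]
    rw [hM]
    have key : ∀ τ, ‖𝓕 (f σ) τ‖ₑ ^ 2 = ‖𝓕 (f 0) τ‖ₑ ^ 2 * ENNReal.ofReal (Real.exp (4 * Real.pi * σ * τ)) := by
      intro τ
      rw [hshift σ h0 h1 τ, enorm_mul, mul_pow]
      have : ‖((Real.exp (-(2 * Real.pi * σ * τ)) : ℝ) : ℂ)‖ₑ ^ 2 = ENNReal.ofReal (Real.exp (-(4 * Real.pi * σ * τ))) := by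
        rw [← ofReal_norm_eq_enorm, ← ENNReal.ofReal_pow (norm_nonneg _)]
        congr 1
        rw [Complex.norm_real, Real.norm_of_nonneg (Real.exp_pos _).le, ← Real.exp_nat_mul]
        push_cast; ring_nf
      rw [this, mul_comm (ENNReal.ofReal _), mul_assoc, ← ENNReal.ofReal_mul (Real.exp_pos _).le,
        ← Real.exp_add]
      simp
    apply add_le_add
    · apply setLIntegral_mono' measurableSet_Ioi
      intro τ hτ
      rw [key]
      have hτ : 0 < τ := hτ
      gcongr
    · rw [← hPl 0 le_rfl hν]
      refine le_trans ?_ (setLIntegral_le_lintegral (Set.Ioi (0:ℝ))ᶜ _)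
      apply setLIntegral_mono' measurableSet_Ioi.compl
      intro τ hτ
      rw [key]
      have hτ : τ ≤ 0 := by simpa using hτ
      have : ENNReal.ofReal (Real.exp (4 * Real.pi * σ * τ)) ≤ 1 := by
        rw [ENNReal.ofReal_le_one, Real.exp_le_one_iff]
        apply mul_nonpos_of_nonneg_of_nonpos _ hτ
        have := Real.pi_pos
        positivity
      calc _ ≤ ‖𝓕 (f 0) τ‖ₑ ^ 2 * 1 := by gcongr
        _ = _ := mul_one _
  set k : ℝ := Real.exp (-(|θ| * ν)) with hk
  have hkpos : 0 < k := Real.exp_pos _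
  have hlower : ∀ δ : ℝ, 0 < δ → 2 * δ < ε → δ < ν → (k * c) ^ 2 / (2 * δ) ≤ M.toReal := by
    intro δ h0 h1 h2
    have hu := hupper (ν - δ) (by linarith) (by linarith)
    have hpt : ∀ x ∈ Set.Ioo (-δ) δ, ENNReal.ofReal ((k * c / (2 * δ)) ^ 2) ≤ ‖f (ν - δ) x‖ₑ ^ 2 := by
      intro x hx
      rw [← ofReal_norm_eq_enorm, ← ENNReal.ofReal_pow (norm_nonneg _)]
      apply ENNReal.ofReal_le_ofReal
      have hxa : |x| < δ := abs_lt.2 hx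
      have n1 : ‖((x : ℂ) - ((ν - δ : ℝ) : ℂ) * I) + ν * I‖ ≤ 2 * δ := by
        have : ((x : ℂ) - ((ν - δ : ℝ) : ℂ) * I) + ν * I = (x : ℂ) + (δ : ℂ) * I := by
          push_cast; ring
        rw [this]
        calc _ ≤ ‖(x : ℂ)‖ + ‖(δ : ℂ) * I‖ := norm_add_le _ _
          _ = |x| + δ := by simp [abs_of_pos h0]
          _ ≤ 2 * δ := by linarith
      have n2 := hlow ((x : ℂ) - ((ν - δ : ℝ) : ℂ) * I) (by simp; linarith) (by linarith)
      have n3 : c / (2 * δ) ≤ ‖h ((x : ℂ) - ((ν - δ : ℝ) : ℂ) * I)‖ := by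
        rw [div_le_iff₀ (by linarith)]
        refine n2.trans ?_
        gcongr
      have n4 : k ≤ ‖cexp (-(θ * (x - ((ν - δ : ℝ) : ℂ) * I)))‖ := by
        rw [norm_exp, hk]
        apply Real.exp_le_exp.2
        simp
        calc θ * x ≤ |θ * x| := le_abs_self _
          _ = |θ| * |x| := abs_mul _ _
          _ ≤ |θ| * ν := by gcongr; linarith
      have : k * c / (2 * δ) ≤ ‖f (ν - δ) x‖ := by
        simp only [hf, norm_mul]
        calc k * c / (2 * δ) = (c / (2 * δ)) * k := by ring
          _ ≤ _ := by gcongr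
      gcongr
    have : ENNReal.ofReal ((k * c / (2 * δ)) ^ 2) * volume (Set.Ioo (-δ) δ) ≤ M := by
      rw [← setLIntegral_const]
      refine le_trans (setLIntegral_mono' measurableSet_Ioo hpt) ?_
      exact (setLIntegral_le_lintegral _ _).trans hu
    rw [Real.volume_Ioo, ← ENNReal.ofReal_mul (by positivity),
      ENNReal.ofReal_le_iff_le_toReal hMfin] at this
    refine le_trans (le_of_eq ?_) this
    field_simp
    ring
  have hkc : 0 < (k * c) ^ 2 := by positivity
  have hM0 : 0 ≤ M.toReal := ENNReal.toReal_nonneg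
  set δ : ℝ := min (min (ε / 4) (ν / 2)) ((k * c) ^ 2 / (4 * (M.toReal + 1))) with hδ
  have hδ0 : 0 < δ := by
    rw [hδ]; refine lt_min (lt_min (by linarith) (by linarith)) (by positivity)
  have d1 : δ ≤ ε / 4 := (min_le_left _ _).trans (min_le_left _ _)
  have d2 : δ ≤ ν / 2 := (min_le_left _ _).trans (min_le_right _ _)
  have d3 : δ ≤ (k * c) ^ 2 / (4 * (M.toReal + 1)) := min_le_right _ _
  have := hlower δ hδ0 (by linarith) (by linarith)
  rw [div_le_iff₀ (by linarith)] at this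
  rw [le_div_iff₀ (by linarith)] at d3
  nlinarith


/-- The function `w / sinh w`, extended by `1` at `0`. -/
noncomputable def Nf (w : ℂ) : ℂ := (dslope Complex.sinh 0 w)⁻¹

lemma Nf_of_ne {w : ℂ} (hw : w ≠ 0) : Nf w = w / Complex.sinh w := by
  rw [Nf, dslope_of_ne _ hw, slope_def_field]
  simp

lemma sinh_ne_zero_of_im {w : ℂ} (hw : w ≠ 0) (h : |w.im| < Real.pi) : Complex.sinh w ≠ 0 := by
  intro h0
  have hre : (Complex.sinh w).re = Real.sinh w.re * Real.cos w.im := by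
    conv_lhs => rw [← re_add_im w, Complex.sinh_add, Complex.sinh_mul_I, Complex.cosh_mul_I]
    simp [← ofReal_sinh, ← ofReal_cosh, ← ofReal_cos, ← ofReal_sin]
  have him : (Complex.sinh w).im = Real.cosh w.re * Real.sin w.im := by
    conv_lhs => rw [← re_add_im w, Complex.sinh_add, Complex.sinh_mul_I, Complex.cosh_mul_I]
    simp [← ofReal_sinh, ← ofReal_cosh, ← ofReal_cos, ← ofReal_sin]
  rw [h0] at hre him
  have hs : Real.sin w.im = 0 := by
    have := him.symm
    simpa [(Real.cosh_pos w.re).ne'] using this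
  rw [abs_lt] at h
  have hi : w.im = 0 := (Real.sin_eq_zero_iff_of_lt_of_lt h.1 h.2).1 hs
  rw [hi] at hre
  have hr : w.re = 0 := by simpa using hre.symm
  exact hw (Complex.ext hr hi)

lemma dslope_sinh_ne {w : ℂ} (h : |w.im| < Real.pi) : dslope Complex.sinh 0 w ≠ 0 := by
  by_cases hw : w = 0
  · subst hw; simp
  · rw [dslope_of_ne _ hw, slope_def_field]
    simp [sinh_ne_zero_of_im hw h, hw]

lemma differentiable_dslope_sinh : Differentiable ℂ (dslope Complex.sinh 0) := by
  have := (Complex.differentiableOn_dslope (s := Set.univ) (c := (0:ℂ)) (f := Complex.sinh)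
    Filter.univ_mem).2 Complex.differentiable_sinh.differentiableOn
  exact differentiableOn_univ.1 this

lemma Nf_differentiableAt {w : ℂ} (h : |w.im| < Real.pi) : DifferentiableAt ℂ Nf w :=
  (differentiable_dslope_sinh w).inv (dslope_sinh_ne h)

lemma Nf_ne_zero {w : ℂ} (h : |w.im| < Real.pi) : Nf w ≠ 0 := inv_ne_zero (dslope_sinh_ne h)

lemma norm_sinh_ge (w : ℂ) (h : 1 ≤ |w.re|) : Real.exp |w.re| / 4 ≤ ‖Complex.sinh w‖ := by
  have h1 : |Real.exp w.re - Real.exp (-w.re)| / 2 ≤ ‖Complex.sinh w‖ := by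
    rw [Complex.sinh, norm_div]
    have := abs_norm_sub_norm_le (cexp w) (cexp (-w))
    rw [norm_exp, norm_exp] at this
    simp only [neg_re] at this
    simp only [RCLike.norm_ofNat]
    linarith
  have h2 : Real.exp |w.re| / 4 ≤ |Real.exp w.re - Real.exp (-w.re)| / 2 := by
    have h3 : |Real.exp w.re - Real.exp (-w.re)| = Real.exp |w.re| - Real.exp (-|w.re|) := by
      rcases le_total 0 w.re with hp | hp
      · rw [abs_of_nonneg hp, abs_of_nonneg]
        have := Real.exp_le_exp.2 (show -w.re ≤ w.re by linarith)
        linarith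
      · rw [abs_of_nonpos hp, abs_of_nonpos]
        · simp
        have := Real.exp_le_exp.2 (show w.re ≤ -w.re by linarith)
        linarith
    rw [h3]
    have e1 : 2 ≤ Real.exp |w.re| := by have := Real.add_one_le_exp |w.re|; linarith
    have e2 : Real.exp (-|w.re|) ≤ 1 := by rw [Real.exp_le_one_iff]; simp
    linarith
  exact h2.trans h1

lemma Nf_bound (τ : ℝ) (hτ : τ < Real.pi) : ∃ C, 0 ≤ C ∧ ∀ w : ℂ, |w.im| ≤ τ →
    ‖Nf w‖ ≤ C * (1 + ‖w‖) * Real.exp (-|w.re|) := by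
  have hK : IsCompact (Set.Icc (-1:ℝ) 1 ×ℂ Set.Icc (-τ) τ) := isCompact_Icc.reProdIm isCompact_Icc
  obtain ⟨C0, hC0⟩ := hK.exists_bound_of_continuousOn (f := Nf) (by
    intro w hw
    rw [mem_reProdIm] at hw
    exact (Nf_differentiableAt (lt_of_le_of_lt (abs_le.2 hw.2) hτ)).continuousAt.continuousWithinAt)
  refine ⟨max 4 (|C0| * Real.exp 1), by positivity, fun w hw => ?_⟩
  rcases le_total 1 |w.re| with h | h
  · have hw0 : w ≠ 0 := by rintro rfl; simp at h; linarith
    rw [Nf_of_ne hw0, norm_div]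
    have h1 := norm_sinh_ge w h
    have h2 : 0 < Real.exp |w.re| / 4 := by positivity
    calc ‖w‖ / ‖Complex.sinh w‖ ≤ ‖w‖ / (Real.exp |w.re| / 4) := by gcongr
      _ = 4 * ‖w‖ * Real.exp (-|w.re|) := by rw [Real.exp_neg]; field_simp
      _ ≤ _ := by
        gcongr
        · exact le_max_left _ _
        · linarith
  · have h1 := hC0 w (by rw [mem_reProdIm]; exact ⟨abs_le.1 h, abs_le.1 hw⟩)
    calc ‖Nf w‖ ≤ |C0| := h1.trans (le_abs_self _)
      _ = |C0| * Real.exp 1 * 1 * Real.exp (-1) := by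
        rw [mul_one, mul_assoc, ← Real.exp_add]; simp
      _ ≤ _ := by
        gcongr
        · exact le_max_right _ _
        · linarith [norm_nonneg w]

/-- `P_m(iξ-1) = ∏_{j<m} (iξ - 1 - j)`. -/
noncomputable def Pf (m : ℕ) (ξ : ℂ) : ℂ := ∏ j ∈ Finset.range m, (I * ξ - 1 - j)

lemma Pf_differentiable (m : ℕ) : Differentiable ℂ (Pf m) := by
  unfold Pf
  fun_prop

lemma Pf_bound (m : ℕ) (ξ : ℂ) : ‖Pf m ξ‖ ≤ (1 + m) ^ m * (1 + ‖ξ‖) ^ m := by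
  rw [Pf, norm_prod, ← mul_pow]
  calc _ ≤ ∏ j ∈ Finset.range m, ((1 + (m:ℝ)) * (1 + ‖ξ‖)) := by
        apply Finset.prod_le_prod (fun _ _ => norm_nonneg _)
        intro j hj
        have hj : (j:ℝ) ≤ m := by exact_mod_cast (Finset.mem_range.1 hj).le
        calc ‖I * ξ - 1 - (j:ℂ)‖ ≤ ‖I * ξ - 1‖ + ‖(j:ℂ)‖ := norm_sub_le _ _
          _ ≤ ‖I * ξ‖ + ‖(1:ℂ)‖ + ‖(j:ℂ)‖ := by gcongr; exact norm_sub_le _ _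
          _ = ‖ξ‖ + 1 + j := by simp
          _ ≤ _ := by nlinarith [norm_nonneg ξ, (Nat.cast_nonneg m : (0:ℝ) ≤ m)]
    _ = _ := by simp

lemma poly_exp_bound (n : ℕ) (η A : ℝ) (hη : 0 < η) (hA : 0 ≤ A) : ∃ C, 0 ≤ C ∧ ∀ x : ℝ,
    (A + |x|) ^ n ≤ C * Real.exp (η * |x|) := by
  refine ⟨n.factorial / η ^ n * Real.exp (η * A), by positivity, fun x => ?_⟩
  have h := Real.pow_div_factorial_le_exp (η * (A + |x|)) (by positivity) n
  rw [div_le_iff₀ (by positivity), mul_pow] at h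
  rw [mul_assoc, ← Real.exp_add, div_mul_eq_mul_div, le_div_iff₀ (by positivity), ← mul_add]
  linarith

/-- The (normalised) spectral density. -/
noncomputable def hf (μ : ℝ) (m : ℕ) (ξ : ℂ) : ℂ :=
  Pf m ξ * (Nf (2 * μ * ξ) ^ 2 * Nf (Real.pi * ξ))

lemma hf_diff (μ : ℝ) (hμ : Real.pi / 2 < μ) (m : ℕ) (ξ : ℂ) (h : |ξ.im| < Real.pi / (2 * μ)) :
    DifferentiableAt ℂ (hf μ m) ξ := by
  have hpi := Real.pi_pos
  have hμ0 : 0 < μ := by linarith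
  rw [lt_div_iff₀ (by linarith)] at h
  have h1 : DifferentiableAt ℂ (fun ξ : ℂ => Nf (2 * μ * ξ)) ξ := by
    apply DifferentiableAt.comp (g := Nf) (f := fun ξ : ℂ => 2 * μ * ξ)
    · apply Nf_differentiableAt
      have : (2 * (μ:ℂ) * ξ).im = 2 * μ * ξ.im := by simp
      rw [this, abs_mul, abs_of_pos (by linarith)]
      linarith
    · fun_prop
  have h2 : DifferentiableAt ℂ (fun ξ : ℂ => Nf (Real.pi * ξ)) ξ := by
    apply DifferentiableAt.comp (g := Nf) (f := fun ξ : ℂ => Real.pi * ξ)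
    · apply Nf_differentiableAt
      have : ((Real.pi:ℂ) * ξ).im = Real.pi * ξ.im := by simp
      rw [this, abs_mul, abs_of_pos (by linarith)]
      nlinarith [abs_nonneg ξ.im]
    · fun_prop
  exact (Pf_differentiable m ξ).mul ((h1.pow 2).mul h2)

lemma hf_bound (μ : ℝ) (hμ : Real.pi / 2 < μ) (m : ℕ) (b : ℝ) (hb : b < 4 * μ + Real.pi)
    (σ : ℝ) (h0 : 0 ≤ σ) (hσ : σ < Real.pi / (2 * μ)) :
    ∃ C, 0 ≤ C ∧ ∀ x y : ℝ, -σ ≤ y → y ≤ 0 → ‖hf μ m (x + y * I)‖ ≤ C * Real.exp (-b * |x|) := by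
  have hpi := Real.pi_pos
  have hμ0 : 0 < μ := by linarith
  rw [lt_div_iff₀ (by linarith)] at hσ
  obtain ⟨C1, hC1, hN1⟩ := Nf_bound (2 * μ * σ) (by linarith)
  obtain ⟨C2, hC2, hN2⟩ := Nf_bound (Real.pi * σ) (by nlinarith)
  obtain ⟨C3, hC3, hp⟩ := poly_exp_bound (m + 3) (4 * μ + Real.pi - b) (1 + σ) (by linarith) (by linarith)
  refine ⟨(1 + m) ^ m * (C1 * (1 + 2 * μ)) ^ 2 * (C2 * (1 + Real.pi)) * C3, by positivity, ?_⟩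
  intro x y hy1 hy2
  set ξ : ℂ := x + y * I with hξ
  have hre : ξ.re = x := by simp [hξ]
  have him : ξ.im = y := by simp [hξ]
  have hya : |y| ≤ σ := abs_le.2 ⟨hy1, by linarith⟩
  have hn : ‖ξ‖ ≤ |x| + σ := by
    calc ‖ξ‖ ≤ |ξ.re| + |ξ.im| := norm_le_abs_re_add_abs_im ξ
      _ ≤ _ := by rw [hre, him]; linarith
  have n1 : ‖Nf (2 * μ * ξ)‖ ≤ (C1 * (1 + 2 * μ)) * (1 + ‖ξ‖) * Real.exp (-(2 * μ * |x|)) := by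
    have := hN1 (2 * μ * ξ) (by
      have : (2 * (μ:ℂ) * ξ).im = 2 * μ * ξ.im := by simp
      rw [this, abs_mul, abs_of_pos (by linarith), him]
      gcongr)
    have e1 : (2 * (μ:ℂ) * ξ).re = 2 * μ * ξ.re := by simp
    rw [e1, abs_mul, abs_of_pos (by linarith : 0 < 2 * μ), hre] at this
    have e2 : ‖2 * (μ:ℂ) * ξ‖ = 2 * μ * ‖ξ‖ := by simp [abs_of_pos hμ0]
    rw [e2] at this
    refine this.trans ?_
    rw [mul_assoc C1 (1 + 2 * μ)]
    gcongr
    nlinarith [norm_nonneg ξ]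
  have n2 : ‖Nf (Real.pi * ξ)‖ ≤ (C2 * (1 + Real.pi)) * (1 + ‖ξ‖) * Real.exp (-(Real.pi * |x|)) := by
    have := hN2 (Real.pi * ξ) (by
      have : ((Real.pi:ℂ) * ξ).im = Real.pi * ξ.im := by simp
      rw [this, abs_mul, abs_of_pos (by linarith), him]
      gcongr)
    have e1 : ((Real.pi:ℂ) * ξ).re = Real.pi * ξ.re := by simp
    rw [e1, abs_mul, abs_of_pos hpi, hre] at this
    have e2 : ‖(Real.pi:ℂ) * ξ‖ = Real.pi * ‖ξ‖ := by simp [abs_of_pos hpi]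
    rw [e2] at this
    refine this.trans ?_
    rw [mul_assoc C2 (1 + Real.pi)]
    gcongr
    nlinarith [norm_nonneg ξ]
  have n3 := Pf_bound m ξ
  have n4 : (1 + ‖ξ‖) ^ (m + 3) ≤ C3 * Real.exp ((4 * μ + Real.pi - b) * |x|) := by
    refine le_trans ?_ (hp x)
    gcongr ?_ ^ _
    linarith
  rw [hf, norm_mul, norm_mul, norm_pow]
  calc _ ≤ ((1 + m) ^ m * (1 + ‖ξ‖) ^ m) * (((C1 * (1 + 2 * μ)) * (1 + ‖ξ‖) * Real.exp (-(2 * μ * |x|))) ^ 2 *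
        ((C2 * (1 + Real.pi)) * (1 + ‖ξ‖) * Real.exp (-(Real.pi * |x|)))) := by
        gcongr
    _ = ((1 + m) ^ m * (C1 * (1 + 2 * μ)) ^ 2 * (C2 * (1 + Real.pi))) *
        (Real.exp (-(2 * μ * |x|)) ^ 2 * Real.exp (-(Real.pi * |x|))) * (1 + ‖ξ‖) ^ (m + 3) := by ring
    _ ≤ ((1 + m) ^ m * (C1 * (1 + 2 * μ)) ^ 2 * (C2 * (1 + Real.pi))) *
        (Real.exp (-(2 * μ * |x|)) ^ 2 * Real.exp (-(Real.pi * |x|))) *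
        (C3 * Real.exp ((4 * μ + Real.pi - b) * |x|)) := by
        gcongr
    _ = _ := by
      have : Real.exp (-b * |x|) = Real.exp (-(2 * μ * |x|)) ^ 2 * Real.exp (-(Real.pi * |x|)) *
        Real.exp ((4 * μ + Real.pi - b) * |x|) := by
        rw [← Real.exp_nat_mul, ← Real.exp_add, ← Real.exp_add]
        push_cast; ring_nf
      rw [this]; ring

lemma hf_pole (μ : ℝ) (hμ : Real.pi / 2 < μ) (m : ℕ) (ν : ℝ) (hν : ν = Real.pi / (2 * μ)) :
    ∃ c > 0, ∃ ε > 0, ∀ ξ : ℂ, -ν < ξ.im → ‖ξ + ν * I‖ < ε → c ≤ ‖hf μ m ξ‖ * ‖ξ + ν * I‖ := by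
  have hpi := Real.pi_pos
  have hμ0 : 0 < μ := by linarith
  have hμν : 2 * μ * ν = Real.pi := by rw [hν]; field_simp
  have hν0 : 0 < ν := by rw [hν]; positivity
  have hν1 : ν < 1 := by rw [hν, div_lt_one (by linarith)]; linarith
  set p : ℂ := -(ν * I) with hp
  have hpim : ((Real.pi : ℂ) * p).im = -(Real.pi * ν) := by simp [hp]
  have hpab : |((Real.pi : ℂ) * p).im| < Real.pi := by
    rw [hpim, abs_neg, abs_of_pos (by positivity)]; nlinarith
  set A : ℂ → ℂ := fun ξ => Pf m ξ * ((2 * μ * ξ) ^ 2 * Nf (Real.pi * ξ)) with hA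
  have hAc : ContinuousAt A p := by
    have h2 : ContinuousAt (fun ξ : ℂ => Nf (Real.pi * ξ)) p :=
      ContinuousAt.comp (g := Nf) (f := fun ξ : ℂ => Real.pi * ξ)
        (Nf_differentiableAt hpab).continuousAt (by fun_prop)
    exact (Pf_differentiable m).continuous.continuousAt.mul (ContinuousAt.mul (by fun_prop) h2)
  have hA0 : A p ≠ 0 := by
    simp only [hA]
    refine mul_ne_zero ?_ (mul_ne_zero ?_ (Nf_ne_zero hpab))
    · rw [Pf, Finset.prod_ne_zero_iff]
      intro j _ h
      have : I * p - 1 - j = ((ν - 1 - j : ℝ) : ℂ) := by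
        rw [hp]; push_cast; ring_nf; rw [I_sq]; ring
      rw [this] at h
      have h := ofReal_eq_zero.1 h
      have : (0:ℝ) ≤ j := Nat.cast_nonneg j
      linarith
    · apply pow_ne_zero
      simp [hp, hμ0.ne', hν0.ne']
  have hAe : ∀ᶠ ξ in nhds p, ‖A p‖ / 2 < ‖A ξ‖ := by
    have : ‖A p‖ / 2 < ‖A p‖ := by have := norm_pos_iff.2 hA0; linarith
    exact hAc.norm.eventually (lt_mem_nhds this)
  have hs0 : Complex.sinh (2 * μ * p) = 0 := by
    have : 2 * (μ:ℂ) * p = -((Real.pi : ℂ) * I) := by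
      rw [hp, ← hμν]; push_cast; ring
    rw [this, Complex.sinh_neg, Complex.sinh_mul_I, Complex.sin_pi]; simp
  have hO : (fun ξ => Complex.sinh (2 * μ * ξ) - Complex.sinh (2 * μ * p)) =O[nhds p] fun ξ => ξ - p := by
    have : DifferentiableAt ℂ (fun ξ : ℂ => Complex.sinh (2 * μ * ξ)) p := by fun_prop
    exact this.hasDerivAt.isBigO_sub
  obtain ⟨C, hC, hOC⟩ := hO.exists_pos
  have hOe := hOC.bound
  rw [hs0] at hOe
  obtain ⟨ε, hε, hball⟩ := Metric.eventually_nhds_iff.1 (hAe.and hOe)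
  refine ⟨‖A p‖ / (2 * C ^ 2), by have := norm_pos_iff.2 hA0; positivity, min ε (min 1 ν), by positivity, ?_⟩
  intro ξ him hξ
  have hd : ξ + ν * I = ξ - p := by rw [hp]; ring
  have hξ1 : ‖ξ + ν * I‖ < ε := lt_of_lt_of_le hξ (min_le_left _ _)
  have hξ2 : ‖ξ + ν * I‖ < 1 := lt_of_lt_of_le hξ ((min_le_right _ _).trans (min_le_left _ _))
  have hξ3 : ‖ξ + ν * I‖ < ν := lt_of_lt_of_le hξ ((min_le_right _ _).trans (min_le_right _ _))
  obtain ⟨b1, b2⟩ := hball (y := ξ) (by rw [dist_eq_norm, ← hd]; exact hξ1)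
  rw [← hd, sub_zero] at b2
  have himd : ξ.im < 0 := by
    have := (abs_im_le_norm (ξ + ν * I)).trans_lt hξ3
    simp at this
    have := (abs_lt.1 this).2
    linarith
  have hξ0 : ξ ≠ 0 := by rintro rfl; simp at himd
  have hw0 : 2 * (μ:ℂ) * ξ ≠ 0 := by simp [hμ0.ne', hξ0]
  have hsn : Complex.sinh (2 * μ * ξ) ≠ 0 := by
    apply sinh_ne_zero_of_im hw0
    have : (2 * (μ:ℂ) * ξ).im = 2 * μ * ξ.im := by simp
    rw [this, abs_mul, abs_of_pos (by linarith), abs_of_neg himd]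
    nlinarith
  have hdpos : 0 < ‖ξ + ν * I‖ := by
    rw [norm_pos_iff]
    intro h0
    have := congrArg Complex.im h0
    simp at this
    linarith
  have hspos : 0 < ‖Complex.sinh (2 * μ * ξ)‖ := norm_pos_iff.2 hsn
  have heq : hf μ m ξ = A ξ / Complex.sinh (2 * μ * ξ) ^ 2 := by
    simp only [hf, hA]
    rw [Nf_of_ne hw0]
    field_simp
  rw [heq, norm_div, norm_pow]
  set d := ‖ξ + ν * I‖
  set S := ‖Complex.sinh (2 * μ * ξ)‖
  have hS2 : S ^ 2 ≤ C ^ 2 * d := by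
    calc S ^ 2 ≤ (C * d) ^ 2 := by gcongr
      _ = C ^ 2 * d * d := by ring
      _ ≤ C ^ 2 * d * 1 := by gcongr
      _ = _ := mul_one _
  rw [div_mul_eq_mul_div, le_div_iff₀ (by positivity)]
  calc ‖A p‖ / (2 * C ^ 2) * S ^ 2 ≤ ‖A p‖ / (2 * C ^ 2) * (C ^ 2 * d) := by gcongr
    _ = ‖A p‖ / 2 * d := by field_simp
    _ ≤ ‖A ξ‖ * d := by gcongr

lemma hf_succ (μ : ℝ) (n : ℕ) (ξ : ℂ) : hf μ (n+1) ξ = hf μ n ξ * (I * ξ - 1 - n) := by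
  simp only [hf, Pf, Finset.prod_range_succ]; ring

/-- The logarithm at fixed `L`. -/
noncomputable def Lam (L : ℝ) (ζ : ℂ) : ℂ := Complex.log (ζ * cexp (-(I * L))) + I * L

/-- Candidate for the derivatives. -/
noncomputable def Jint (μ L : ℝ) (w' : ℂ) (n : ℕ) (ζ : ℂ) (ξ : ℝ) : ℂ :=
  hf μ n ξ * cexp ((I * ξ - 1 - n) * Lam L ζ) * cexp ((-(I * ξ) - 1) * conj w')

lemma Lam_im_bound (L : ℝ) (ζ : ℂ) (hζ : 0 < (ζ * cexp (-(I * L))).re) :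
    |(Lam L ζ).im| ≤ Real.pi / 2 + |L| := by
  have h1 : (Lam L ζ).im = (ζ * cexp (-(I * L))).arg + L := by
    simp [Lam, Complex.log_im]
  rw [h1]
  have := (Complex.abs_arg_lt_pi_div_two_iff.2 (Or.inl hζ)).le
  exact (abs_add_le _ _).trans (by linarith)

lemma Lam_deriv (L : ℝ) (ζ : ℂ) (hζ : 0 < (ζ * cexp (-(I * L))).re) :
    HasDerivAt (Lam L) (cexp (-(Lam L ζ))) ζ := by
  have h0 : ζ * cexp (-(I * L)) ≠ 0 := by intro h; rw [h] at hζ; simp at hζ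
  have h1 : HasDerivAt (fun ζ : ℂ => ζ * cexp (-(I * L))) (cexp (-(I * L))) ζ := by
    simpa using (hasDerivAt_id ζ).mul_const (cexp (-(I * L)))
  have h2 := (h1.clog (Or.inl hζ)).add_const (I * (L : ℂ))
  have h3 : cexp (-(Lam L ζ)) = cexp (-(I * L)) / (ζ * cexp (-(I * L))) := by
    rw [Lam, neg_add, Complex.exp_add, Complex.exp_neg (Complex.log _), Complex.exp_log h0]
    field_simp
  rw [h3]
  exact h2

lemma hf_real_cont (μ : ℝ) (hμ : Real.pi / 2 < μ) (n : ℕ) : Continuous (fun ξ : ℝ => hf μ n ξ) := by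
  rw [continuous_iff_continuousAt]
  intro x
  have hpi := Real.pi_pos
  have : 0 < μ := by linarith
  have := (hf_diff μ hμ n x (by simp; positivity)).continuousAt
  exact ContinuousAt.comp (f := fun x : ℝ => (x : ℂ)) this (by fun_prop)

lemma Jint_cont (μ L : ℝ) (hμ : Real.pi / 2 < μ) (w' : ℂ) (n : ℕ) (ζ : ℂ) :
    Continuous (Jint μ L w' n ζ) := by
  have := hf_real_cont μ hμ n
  unfold Jint
  fun_prop

lemma Jint_bound (μ L : ℝ) (hμ : Real.pi / 2 < μ) (hL : |L| < 2 * μ) (w' : ℂ)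
    (hw' : |w'.im| < 2 * μ + Real.pi / 2) (n : ℕ) : ∃ C c : ℝ, 0 ≤ C ∧ 0 < c ∧
    ∀ (R : ℝ) (ζ : ℂ), 0 < (ζ * cexp (-(I * L))).re → -(Lam L ζ).re ≤ R → ∀ ξ : ℝ,
      ‖Jint μ L w' n ζ ξ‖ ≤ C * Real.exp ((1 + n) * R) * Real.exp (-c * |ξ|) := by
  have hpi := Real.pi_pos
  have hμ0 : 0 < μ := by linarith
  set a := Real.pi / 2 + |L| + |w'.im| with ha
  have ha1 : a < 4 * μ + Real.pi := by rw [ha]; linarith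
  obtain ⟨C, hC0, hC⟩ := hf_bound μ hμ n ((a + (4 * μ + Real.pi)) / 2) (by linarith) 0 le_rfl (by positivity)
  refine ⟨C * Real.exp (-w'.re), (4 * μ + Real.pi - a) / 2, by positivity, by linarith, ?_⟩
  intro R ζ hζ hR ξ
  have e1 := hC ξ 0 (by simp) le_rfl
  simp only [ofReal_zero, zero_mul, add_zero] at e1
  have e2 : ‖cexp ((I * ξ - 1 - n) * Lam L ζ)‖ ≤ Real.exp ((Real.pi / 2 + |L|) * |ξ| + (1 + n) * R) := by
    rw [norm_exp]
    apply Real.exp_le_exp.2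
    have : ((I * ξ - 1 - n) * Lam L ζ).re = -(ξ * (Lam L ζ).im) + (1 + n) * (-(Lam L ζ).re) := by
      simp; ring
    rw [this]
    apply add_le_add
    · calc -(ξ * (Lam L ζ).im) ≤ |ξ * (Lam L ζ).im| := neg_le_abs _
        _ = |(Lam L ζ).im| * |ξ| := by rw [abs_mul, mul_comm]
        _ ≤ _ := by gcongr; exact Lam_im_bound L ζ hζ
    · gcongr
  have e3 : ‖cexp ((-(I * ξ) - 1) * conj w')‖ ≤ Real.exp (|w'.im| * |ξ| + -w'.re) := by
    rw [norm_exp]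
    apply Real.exp_le_exp.2
    have : ((-(I * ξ) - 1) * conj w').re = -(ξ * w'.im) + -w'.re := by
      simp; ring
    rw [this]
    gcongr
    calc -(ξ * w'.im) ≤ |ξ * w'.im| := neg_le_abs _
        _ = |w'.im| * |ξ| := by rw [abs_mul, mul_comm]
  rw [Jint, norm_mul, norm_mul]
  calc _ ≤ (C * Real.exp (-((a + (4 * μ + Real.pi)) / 2) * |ξ|)) *
      Real.exp ((Real.pi / 2 + |L|) * |ξ| + (1 + n) * R) * Real.exp (|w'.im| * |ξ| + -w'.re) := by
        gcongr
    _ = C * (Real.exp (-((a + (4 * μ + Real.pi)) / 2) * |ξ|) *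
      Real.exp ((Real.pi / 2 + |L|) * |ξ| + (1 + n) * R) * Real.exp (|w'.im| * |ξ| + -w'.re)) := by ring
    _ = C * (Real.exp (-w'.re) * Real.exp ((1 + n) * R) * Real.exp (-((4 * μ + Real.pi - a) / 2) * |ξ|)) := by
      rw [← Real.exp_add, ← Real.exp_add, ← Real.exp_add, ← Real.exp_add]
      rw [ha]; ring_nf
    _ = _ := by ring

lemma Jint_integrable (μ L : ℝ) (hμ : Real.pi / 2 < μ) (hL : |L| < 2 * μ) (w' : ℂ)
    (hw' : |w'.im| < 2 * μ + Real.pi / 2) (n : ℕ) (ζ : ℂ) (hζ : 0 < (ζ * cexp (-(I * L))).re) :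
    Integrable (Jint μ L w' n ζ) := by
  obtain ⟨C, c, hC, hc, hb⟩ := Jint_bound μ L hμ hL w' hw' n
  exact ((integrable_exp_abs c hc).const_mul _).mono' (Jint_cont μ L hμ w' n ζ).aestronglyMeasurable
    (Filter.Eventually.of_forall (hb _ ζ hζ le_rfl))

lemma isOpen_half (L : ℝ) : IsOpen {ζ : ℂ | 0 < (ζ * cexp (-(I * L))).re} := by
  apply isOpen_lt continuous_const
  fun_prop

lemma J_hasDerivAt (μ L : ℝ) (hμ : Real.pi / 2 < μ) (hL : |L| < 2 * μ) (w' : ℂ)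
    (hw' : |w'.im| < 2 * μ + Real.pi / 2) (n : ℕ) (ζ : ℂ) (hζ : 0 < (ζ * cexp (-(I * L))).re) :
    HasDerivAt (fun ζ => ∫ ξ, Jint μ L w' n ζ ξ) (∫ ξ, Jint μ L w' (n+1) ζ ξ) ζ := by
  obtain ⟨C, c, hC, hc, hb⟩ := Jint_bound μ L hμ hL w' hw' (n+1)
  have hcont : ContinuousAt (fun ζ => -(Lam L ζ).re) ζ :=
    (Complex.continuous_re.continuousAt.comp (Lam_deriv L ζ hζ).continuousAt).neg
  have hev : ∀ᶠ z in nhds ζ, -(Lam L z).re < -(Lam L ζ).re + 1 :=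
    hcont.eventually (gt_mem_nhds (by linarith))
  have hev2 := hev.and ((isOpen_half L).mem_nhds hζ)
  refine (hasDerivAt_integral_of_dominated_loc_of_deriv_le (s := {z | -(Lam L z).re < -(Lam L ζ).re + 1 ∧
      0 < (z * cexp (-(I * L))).re})
    (F := fun ζ ξ => Jint μ L w' n ζ ξ) (F' := fun ζ ξ => Jint μ L w' (n+1) ζ ξ)
    (bound := fun ξ => C * Real.exp ((1 + (n+1:ℕ)) * (-(Lam L ζ).re + 1)) * Real.exp (-c * |ξ|))
    hev2 ?_ ?_ ?_ ?_ ?_ ?_).2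
  · exact Filter.Eventually.of_forall fun z => (Jint_cont μ L hμ w' n z).aestronglyMeasurable
  · exact Jint_integrable μ L hμ hL w' hw' n ζ hζ
  · exact (Jint_cont μ L hμ w' _ _).aestronglyMeasurable
  · exact Filter.Eventually.of_forall fun ξ z hz => hb _ z hz.2 hz.1.le ξ
  · exact (integrable_exp_abs c hc).const_mul _
  · refine Filter.Eventually.of_forall fun ξ z hz => ?_
    have h1 := (((Lam_deriv L z hz.2).const_mul (I * ξ - 1 - n)).cexp.const_mul (hf μ n ξ)).mul_const
      (cexp ((-(I * ξ) - 1) * conj w'))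
    have h2 : Jint μ L w' (n+1) z ξ = hf μ n ξ * (cexp ((I * ξ - 1 - n) * Lam L z) *
        ((I * ξ - 1 - n) * cexp (-Lam L z))) * cexp ((-(I * ξ) - 1) * conj w') := by
      rw [Jint, hf_succ]
      have : cexp ((I * ξ - 1 - (n+1:ℕ)) * Lam L z) = cexp ((I * ξ - 1 - n) * Lam L z) * cexp (-Lam L z) := by
        rw [← Complex.exp_add]; congr 1; push_cast; ring
      rw [this]; ring
    rw [h2]
    exact h1

lemma iteratedDeriv_formula (μ L : ℝ) (hμ : Real.pi / 2 < μ) (hL : |L| < 2 * μ) (w' : ℂ)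
    (hw' : |w'.im| < 2 * μ + Real.pi / 2) (c0 : ℂ) (f : ℂ → ℂ)
    (hf0 : ∀ ζ : ℂ, 0 < (ζ * cexp (-(I * L))).re → f ζ = c0 * ∫ ξ, Jint μ L w' 0 ζ ξ) (n : ℕ) :
    ∀ ζ : ℂ, 0 < (ζ * cexp (-(I * L))).re →
      iteratedDeriv n f ζ = c0 * ∫ ξ, Jint μ L w' n ζ ξ := by
  induction n with
  | zero => simpa using hf0
  | succ n ih =>
    intro ζ hζ
    rw [iteratedDeriv_succ]
    have he : iteratedDeriv n f =ᶠ[nhds ζ] fun ζ => c0 * ∫ ξ, Jint μ L w' n ζ ξ := by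
      filter_upwards [(isOpen_half L).mem_nhds hζ] with z hz
      exact ih z hz
    rw [he.deriv_eq]
    exact ((J_hasDerivAt μ L hμ hL w' hw' n ζ hζ).const_mul c0).deriv

lemma Kker_formula (μ : ℝ) (hμ : Real.pi / 2 < μ) (z2 z3 : ℂ) (z' : ℂ × ℂ × ℂ) (ζ : ℂ) :
    Kker μ (ζ, z2, z3) z' = ((z2 * conj z'.2.1 * z3 * conj z'.2.2)⁻¹ *
      (8 * μ ^ 2 * (Real.pi : ℂ) ^ 4)⁻¹) * ∫ ξ, Jint μ (Lofz (ζ, z2, z3)) (ellfun z') 0 ζ ξ := by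
  have hpi := Real.pi_pos
  have hμ0 : 0 < μ := by linarith
  have hμc : (μ : ℂ) ≠ 0 := by exact_mod_cast hμ0.ne'
  have hpc : (Real.pi : ℂ) ≠ 0 := by exact_mod_cast hpi.ne'
  rw [Kker]
  simp only
  rw [mul_assoc ((z2 * conj z'.2.1 * z3 * conj z'.2.2)⁻¹)]
  congr 1
  rw [← integral_const_mul]
  apply integral_congr_ae
  have : ∀ᵐ ξ : ℝ, ξ ≠ 0 := by
    rw [ae_iff]; simp
  filter_upwards [this] with ξ hξ
  have hξc : (ξ : ℂ) ≠ 0 := by exact_mod_cast hξ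
  have s1 : Complex.sinh (2 * μ * ξ) ≠ 0 :=
    sinh_ne_zero_of_im (by simp [hμc, hξc]) (by simp [hpi])
  have s2 : Complex.sinh (Real.pi * ξ) ≠ 0 :=
    sinh_ne_zero_of_im (by simp [hpc, hξc]) (by simp [hpi])
  have e1 : hf μ 0 ξ = (2 * μ * ξ / Complex.sinh (2 * μ * ξ)) ^ 2 * (Real.pi * ξ / Complex.sinh (Real.pi * ξ)) := by
    rw [hf, Nf_of_ne (by simp [hμc, hξc]), Nf_of_ne (by simp [hpc, hξc])]
    simp [Pf]
  have e2 : Efun (I * ξ - 1) (ζ, z2, z3) = cexp ((I * ξ - 1 - (0:ℕ)) * Lam (Lofz (ζ, z2, z3)) ζ) := by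
    simp [Efun, ellfun, Lam]
  have e3 : conj (Efun (I * ξ - 1) z') = cexp ((-(I * ξ) - 1) * conj (ellfun z')) := by
    rw [Efun, ← Complex.exp_conj]
    simp
  rw [Jint, e1, e2, e3]
  field_simp
  ring


lemma J_shift (μ L : ℝ) (w' : ℂ) (m : ℕ) (ζ : ℂ) (τ θ : ℝ)
    (hre : (Lam L ζ).re = w'.re - 2 * Real.pi * τ) (hθ : (Lam L ζ).im + w'.im = θ) :
    ∫ ξ, Jint μ L w' m ζ ξ = (∫ x : ℝ, hf μ m x * cexp (-(θ * x)) *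
      cexp (-(2 * Real.pi * x * τ * I))) * cexp (-(1 + m) * Lam L ζ - conj w') := by
  rw [← integral_mul_const]
  congr 1
  ext x
  rw [Jint, mul_assoc, mul_assoc, mul_assoc, ← Complex.exp_add, ← Complex.exp_add,
    ← Complex.exp_add]
  congr 2
  have h1 : Lam L ζ = (w'.re - 2 * Real.pi * τ : ℝ) + (Lam L ζ).im * I := by
    rw [← hre, re_add_im]
  have h2 : conj w' = w'.re - w'.im * I := by
    apply Complex.ext <;> simp
  rw [← hθ, h2, h1]
  simp only [ofReal_add, ofReal_sub, ofReal_mul, ofReal_ofNat, add_re, add_im, sub_re, sub_im,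
    mul_re, mul_im, ofReal_re, ofReal_im, I_re, I_im, re_ofNat, im_ofNat]
  push_cast
  ring_nf
  simp only [I_sq]
  ring

lemma exists_angle (L : ℝ) : ∃ φ ∈ Set.Ioo (-Real.pi) Real.pi, 0 < Real.cos (φ - L) := by
  have hpi := Real.pi_pos
  by_cases h1 : 0 < Real.cos L
  · exact ⟨0, ⟨by linarith, by linarith⟩, by simpa using h1⟩
  by_cases h2 : 0 < Real.sin L
  · refine ⟨Real.pi / 2, ⟨by linarith, by linarith⟩, ?_⟩
    rwa [Real.cos_pi_div_two_sub]
  by_cases h3 : Real.sin L < 0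
  · refine ⟨-(Real.pi / 2), ⟨by linarith, by linarith⟩, ?_⟩
    rw [Real.cos_sub]
    simp [h3]
  have h4 : Real.sin L = 0 := le_antisymm (not_lt.1 h2) (not_lt.1 h3)
  have h5 : Real.cos L < 0 := by
    rcases lt_or_eq_of_le (not_lt.1 h1) with h | h
    · exact h
    · have := Real.sin_sq_add_cos_sq L
      rw [h, h4] at this
      norm_num at this
  refine ⟨Real.pi - Real.pi / 3, ⟨by linarith, by linarith⟩, ?_⟩
  rw [Real.cos_sub, h4, Real.cos_pi_sub, Real.cos_pi_div_three]
  linarith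

lemma slice_false (μ L : ℝ) (hμ : Real.pi / 2 < μ) (hL : |L| < 2 * μ) (w' : ℂ)
    (hw' : |w'.im| < 2 * μ + Real.pi / 2) (m : ℕ) (s : ℝ)
    (hms : Real.pi / (2 * μ) ≤ (m : ℝ) - s) (c : ℂ) (hc : c ≠ 0)
    (h : IntegrableOn (fun ζ : ℂ => ((ζ * cexp (-(I * L))).re ^ s *
      ‖c * ∫ ξ, Jint μ L w' m ζ ξ‖) ^ 2) {ζ : ℂ | 0 < (ζ * cexp (-(I * L))).re}) : False := by
  have hpi := Real.pi_pos
  have hμ0 : 0 < μ := by linarith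
  set H : Set ℂ := {ζ : ℂ | 0 < (ζ * cexp (-(I * L))).re} with hH
  have hHo : IsOpen H := isOpen_half L
  set g0 : ℂ → ℝ := fun ζ : ℂ => ((ζ * cexp (-(I * L))).re ^ s *
      ‖c * ∫ ξ, Jint μ L w' m ζ ξ‖) ^ 2 with hg0
  have hcont : ContinuousOn g0 H := by
    intro ζ hζ
    apply ContinuousAt.continuousWithinAt
    have hJ := (J_hasDerivAt μ L hμ hL w' hw' m ζ hζ).continuousAt
    have h1 : ContinuousAt (fun ζ : ℂ => (ζ * cexp (-(I * L))).re) ζ := by fun_prop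
    have h2 := h1.rpow_const (p := s) (Or.inl (ne_of_gt hζ))
    exact (h2.mul (continuousAt_const.mul hJ).norm).pow 2
  set g : ℂ → ENNReal := H.indicator (fun ζ => ENNReal.ofReal (g0 ζ)) with hg
  have hgm : Measurable g := by
    have : Measurable (H.indicator g0) := by
      classical
      have := hcont.measurable_piecewise (g := (0 : ℂ → ℝ)) continuousOn_const hHo.measurableSet
      rwa [Set.piecewise_eq_indicator] at this
    have h2 : g = fun ζ => ENNReal.ofReal (H.indicator g0 ζ) := by
      ext ζ
      by_cases hz : ζ ∈ H <;> simp [hg, hz]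
    rw [h2]
    exact this.ennreal_ofReal
  have hgfin : ∫⁻ ζ, g ζ < ⊤ := by
    rw [hg, lintegral_indicator hHo.measurableSet]
    exact h.lintegral_lt_top
  have hpm : Measurable (fun p : ℝ × ℝ => ENNReal.ofReal p.1 • g (Complex.polarCoord.symm p)) := by
    have h1 : Measurable (fun p : ℝ × ℝ => Complex.polarCoord.symm p) := by
      have : (fun p : ℝ × ℝ => Complex.polarCoord.symm p) =
          fun p : ℝ × ℝ => (p.1 * (Real.cos p.2 + Real.sin p.2 * I) : ℂ) := by
        ext p
        exact Complex.polarCoord_symm_apply p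
      rw [this]
      fun_prop
    exact (measurable_fst.ennreal_ofReal).mul (hgm.comp h1)
  rw [← Complex.lintegral_comp_polarCoord_symm, polarCoord_target, Measure.volume_eq_prod,
    ← Measure.prod_restrict, lintegral_prod_symm' _ hpm] at hgfin
  have hae := ae_lt_top' (Measurable.lintegral_prod_left' hpm).aemeasurable hgfin.ne
  rw [ae_restrict_iff' measurableSet_Ioo] at hae
  have hdense := Measure.dense_of_ae hae
  have hU : IsOpen (Set.Ioo (-Real.pi) Real.pi ∩ {φ | 0 < Real.cos (φ - L)}) :=
    isOpen_Ioo.inter (isOpen_lt continuous_const (by fun_prop))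
  obtain ⟨φ0, hφ0, hφ0'⟩ := exists_angle L
  obtain ⟨φ, ⟨hφ, hcos⟩, hfin⟩ := hdense.inter_open_nonempty _ hU ⟨φ0, hφ0, hφ0'⟩
  have hfin := hfin hφ
  change 0 < Real.cos (φ - L) at hcos
  simp only [smul_eq_mul, Complex.polarCoord_symm_apply] at hfin
  -- change of variables
  set a := w'.re with ha
  set rr : ℝ → ℝ := fun τ => Real.exp (a - 2 * Real.pi * τ) with hrr
  have hrd : ∀ τ, HasDerivAt rr (rr τ * (-(2 * Real.pi))) τ := by
    intro τ
    have := (((hasDerivAt_id τ).const_mul (2 * Real.pi)).const_sub a).exp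
    simpa [hrr] using this
  have hinj : Set.InjOn rr (Set.Ioi 0) := by
    intro x _ y _ hxy
    have := Real.exp_injective hxy
    have : 2 * Real.pi * x = 2 * Real.pi * y := by linarith
    exact mul_left_cancel₀ (by positivity) this
  have hfin2 := (lintegral_mono_set (μ := volume) (f := fun r => ENNReal.ofReal r *
      g (r * (Real.cos φ + Real.sin φ * I)))
    (show rr '' (Set.Ioi 0) ⊆ Set.Ioi 0 from by
      rintro _ ⟨τ, _, rfl⟩; exact Real.exp_pos _)).trans_lt hfin
  rw [lintegral_image_eq_lintegral_abs_deriv_mul measurableSet_Ioi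
    (fun x _ => (hrd x).hasDerivWithinAt) hinj] at hfin2
  set u : ℂ := (Real.cos φ + Real.sin φ * I) * cexp (-(I * L)) with hu
  have hu' : u = cexp (I * (φ - L : ℝ)) := by
    rw [hu, ofReal_cos, ofReal_sin, ← Complex.exp_mul_I, ← Complex.exp_add]
    congr 1
    push_cast
    ring
  have hure : u.re = Real.cos (φ - L) := by
    rw [hu', mul_comm, Complex.exp_ofReal_mul_I_re]
  have hun : ‖u‖ = 1 := by
    rw [hu', mul_comm, Complex.norm_exp_ofReal_mul_I]
  have hru : ∀ r : ℝ, (r * (Real.cos φ + Real.sin φ * I)) * cexp (-(I * L)) = r * u := by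
    intro r; rw [hu]; ring
  set θ : ℝ := u.arg + L + w'.im with hθ
  have hLre : ∀ r : ℝ, 0 < r → (Lam L (r * (Real.cos φ + Real.sin φ * I))).re = Real.log r := by
    intro r hr
    rw [Lam, hru]
    simp [Complex.log_re, hun, abs_of_pos hr]
  have hLim : ∀ r : ℝ, 0 < r → (Lam L (r * (Real.cos φ + Real.sin φ * I))).im = u.arg + L := by
    intro r hr
    rw [Lam, hru]
    simp [Complex.log_im, Complex.arg_real_mul u hr]
  have hmem : ∀ r : ℝ, 0 < r → ((r * (Real.cos φ + Real.sin φ * I)) : ℂ) ∈ H := by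
    intro r hr
    rw [hH, Set.mem_ofPred_eq, hru, re_ofReal_mul, hure]
    positivity
  have hθb : |θ| < 4 * μ + Real.pi := by
    have h1 := Lam_im_bound L _ (hmem 1 one_pos)
    rw [hLim 1 one_pos] at h1
    calc |θ| ≤ |u.arg + L| + |w'.im| := abs_add_le _ _
      _ < _ := by linarith
  obtain ⟨b, hb1, hb2⟩ := exists_between hθb
  set G : ℝ → ℂ := fun τ => ∫ x : ℝ, hf μ m x * cexp (-(θ * x)) *
      cexp (-(2 * Real.pi * x * τ * I)) with hG
  have hJn : ∀ τ : ℝ, ‖∫ ξ, Jint μ L w' m (rr τ * (Real.cos φ + Real.sin φ * I)) ξ‖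
      = ‖G τ‖ * Real.exp (-(1 + m) * (a - 2 * Real.pi * τ) - a) := by
    intro τ
    have hr : 0 < rr τ := Real.exp_pos _
    have hl : Real.log (rr τ) = a - 2 * Real.pi * τ := Real.log_exp _
    rw [J_shift μ L w' m _ τ θ (by rw [hLre _ hr, hl]) (by rw [hLim _ hr]), norm_mul,
      Complex.norm_exp]
    congr 2
    have h1 : (-(1 + (m:ℂ))) = ((-(1 + m) : ℝ) : ℂ) := by push_cast; ring
    rw [sub_re, h1, re_ofReal_mul, hLre _ hr, hl, conj_re]
  set C : ℝ := 2 * Real.pi * (Real.cos (φ - L) ^ s) ^ 2 * ‖c‖ ^ 2 *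
    Real.exp (-2 * (m - s) * a - 2 * a) with hC
  have hCpos : 0 < C := by
    have : 0 < ‖c‖ := norm_pos_iff.2 hc
    positivity
  have hpt : ∀ τ ∈ Set.Ioi (0:ℝ), ENNReal.ofReal C * (‖G τ‖ₑ ^ 2 *
      ENNReal.ofReal (Real.exp (4 * Real.pi * (Real.pi / (2 * μ)) * τ))) ≤
      ENNReal.ofReal |rr τ * (-(2 * Real.pi))| * (ENNReal.ofReal (rr τ) *
      g (rr τ * (Real.cos φ + Real.sin φ * I))) := by
    intro τ hτ
    have hτ0 : 0 < τ := hτ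
    have hr : 0 < rr τ := Real.exp_pos _
    rw [hg, Set.indicator_of_mem (hmem _ hr), ← ofReal_norm, ← ENNReal.ofReal_pow (norm_nonneg _),
      ← ENNReal.ofReal_mul (by positivity), ← ENNReal.ofReal_mul hCpos.le,
      ← ENNReal.ofReal_mul hr.le, ← ENNReal.ofReal_mul (abs_nonneg _)]
    apply ENNReal.ofReal_le_ofReal
    have e1 : |rr τ * (-(2 * Real.pi))| = rr τ * (2 * Real.pi) := by
      rw [abs_mul, abs_neg, abs_of_pos hr, abs_of_pos (by positivity)]
    rw [e1, hg0]
    simp only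
    rw [hru, re_ofReal_mul, hure, norm_mul, hJn, Real.mul_rpow hr.le hcos.le]
    have e2 : rr τ ^ s = Real.exp ((a - 2 * Real.pi * τ) * s) := by
      rw [hrr, ← Real.exp_mul]
    have e3 : Real.exp (4 * Real.pi * (Real.pi / (2 * μ)) * τ) ≤
        Real.exp (4 * Real.pi * (m - s) * τ) := by
      gcongr
    have e4 : rr τ * (2 * Real.pi) * (rr τ * (rr τ ^ s * Real.cos (φ - L) ^ s * (‖c‖ * (‖G τ‖ *
        Real.exp (-(1 + m) * (a - 2 * Real.pi * τ) - a)))) ^ 2) =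
        C * (‖G τ‖ ^ 2 * Real.exp (4 * Real.pi * (m - s) * τ)) := by
      have e5 : rr τ * rr τ * (rr τ ^ s) ^ 2 *
          Real.exp (-(1 + m) * (a - 2 * Real.pi * τ) - a) ^ 2 =
          Real.exp (-2 * (m - s) * a - 2 * a) * Real.exp (4 * Real.pi * (m - s) * τ) := by
        rw [e2, hrr]
        simp only [← Real.exp_add, ← Real.exp_nat_mul]
        congr 1
        push_cast
        ring
      rw [hC]
      linear_combination (2 * Real.pi * (Real.cos (φ - L) ^ s) ^ 2 * ‖c‖ ^ 2 * ‖G τ‖ ^ 2) * e5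
    rw [e4]
    gcongr
  have hfin3 := (setLIntegral_mono' measurableSet_Ioi hpt).trans_lt hfin2
  rw [lintegral_const_mul' _ _ ENNReal.ofReal_ne_top] at hfin3
  have hfin4 : ∫⁻ τ in Set.Ioi (0:ℝ), ‖G τ‖ₑ ^ 2 *
      ENNReal.ofReal (Real.exp (4 * Real.pi * (Real.pi / (2 * μ)) * τ)) < ⊤ := by
    by_contra hcon
    rw [not_lt, top_le_iff] at hcon
    rw [hcon, ENNReal.mul_top (by simpa using hCpos)] at hfin3
    exact lt_irrefl _ hfin3
  refine not_L2_core (hf μ m) (Real.pi / (2 * μ)) b θ (by positivity) hb1 ?_ ?_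
    (hf_pole μ hμ m _ rfl) hfin4
  · intro ξ h1 h2
    apply hf_diff μ hμ
    rw [abs_lt]
    exact ⟨h1, lt_of_le_of_lt h2 (by positivity)⟩
  · intro σ h0 h1
    obtain ⟨C, -, hC⟩ := hf_bound μ hμ m b hb2 σ h0 h1
    exact ⟨C, hC⟩


lemma Lofz_measurable : Measurable Lofz := by
  unfold Lofz
  fun_prop

lemma Dmod_measurable (μ : ℝ) : MeasurableSet (Dmod μ) := by
  have hL := Lofz_measurable
  have h1 : Measurable fun z : ℂ × ℂ × ℂ => (z.1 * Complex.exp (-(Complex.I * (Lofz z : ℂ)))).re := by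
    fun_prop
  have h2 : Measurable fun z : ℂ × ℂ × ℂ => Real.log (‖z.2.1‖ ^ 2) := by fun_prop
  have h3 : Measurable fun z : ℂ × ℂ × ℂ => Real.log (‖z.2.2‖ ^ 2) := by fun_prop
  have h4 : Measurable fun z : ℂ × ℂ × ℂ => z.2.1 := by fun_prop
  have h5 : Measurable fun z : ℂ × ℂ × ℂ => z.2.2 := by fun_prop
  exact (h4 (measurableSet_singleton 0).compl).inter ((h5 (measurableSet_singleton 0).compl).inter
    ((measurableSet_lt measurable_const h1).inter ((measurableSet_lt measurable_const h2).inter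
    ((measurableSet_lt h2 measurable_const).inter ((measurableSet_lt measurable_const h3).inter
    (measurableSet_lt h3 measurable_const))))))

lemma Lofz_abs_lt (μ : ℝ) (z : ℂ × ℂ × ℂ) (h2 : z.2.1 ≠ 0) (h3 : z.2.2 ≠ 0)
    (a1 : -μ < Real.log (‖z.2.1‖ ^ 2)) (a2 : Real.log (‖z.2.1‖ ^ 2) < μ)
    (b1 : -μ < Real.log (‖z.2.2‖ ^ 2)) (b2 : Real.log (‖z.2.2‖ ^ 2) < μ) :
    |Lofz z| < 2 * μ := by
  have : Lofz z = Real.log (‖z.2.1‖ ^ 2) + Real.log (‖z.2.2‖ ^ 2) := by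
    rw [Lofz, norm_mul, mul_pow, Real.log_mul (by positivity) (by positivity)]
  rw [this, abs_lt]
  constructor <;> linarith

/-- For `μ > π/2`, `ν = π/(2μ)`, `z' ∈ D_μ`, `m ∈ ℕ` and `s ∈ [0,1)` with `m − s ≥ ν`, the
function `z ↦ (Re(z₁e^{−i log|z₂z₃|²}))^s · ∂₁^m K(z,z')` is not square-integrable on `D_μ`. -/
theorem kernel_derivative_not_L2 (μ : ℝ) (hμ : Real.pi / 2 < μ) (z' : ℂ × ℂ × ℂ)
    (hz' : z' ∈ Dmod μ) (m : ℕ) (s : ℝ) (hs0 : 0 ≤ s) (hs1 : s < 1)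
    (hms : Real.pi / (2 * μ) ≤ (m : ℝ) - s) :
    ¬ IntegrableOn (fun z : ℂ × ℂ × ℂ =>
        (((z.1 * Complex.exp (-(Complex.I * (Lofz z : ℂ)))).re ^ s) *
          ‖iteratedDeriv m (fun ζ : ℂ => Kker μ (ζ, z.2.1, z.2.2) z') z.1‖) ^ 2)
      (Dmod μ) volume := by
  intro hint
  have hpi := Real.pi_pos
  have hμ0 : 0 < μ := by linarith
  have hμc : (μ : ℂ) ≠ 0 := by exact_mod_cast hμ0.ne'
  have hpc : (Real.pi : ℂ) ≠ 0 := by exact_mod_cast hpi.ne'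
  obtain ⟨hz2, hz3, hzre, c1, c2, c3, c4⟩ := hz'
  have hw' : |(ellfun z').im| < 2 * μ + Real.pi / 2 := by
    have h1 := Lam_im_bound (Lofz z') z'.1 hzre
    have h2 := Lofz_abs_lt μ z' hz2 hz3 c1 c2 c3 c4
    have h3 : ellfun z' = Lam (Lofz z') z'.1 := rfl
    rw [h3]
    linarith
  rw [← integrable_indicator_iff (Dmod_measurable μ), Measure.volume_eq_prod] at hint
  have hdense := Measure.dense_of_ae hint.prod_left_ae
  have hev : ∀ᶠ y : ℂ × ℂ in nhds (1, 1), (y.1 ≠ 0 ∧ y.2 ≠ 0) ∧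
      (-μ < Real.log (‖y.1‖ ^ 2) ∧ Real.log (‖y.1‖ ^ 2) < μ) ∧
      (-μ < Real.log (‖y.2‖ ^ 2) ∧ Real.log (‖y.2‖ ^ 2) < μ) := by
    have k1 : ContinuousAt (fun y : ℂ × ℂ => Real.log (‖y.1‖ ^ 2)) (1, 1) :=
      ContinuousAt.log (by fun_prop) (by simp)
    have k2 : ContinuousAt (fun y : ℂ × ℂ => Real.log (‖y.2‖ ^ 2)) (1, 1) :=
      ContinuousAt.log (by fun_prop) (by simp)
    have k3 : ContinuousAt (fun y : ℂ × ℂ => y.1) (1, 1) := by fun_prop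
    have k4 : ContinuousAt (fun y : ℂ × ℂ => y.2) (1, 1) := by fun_prop
    exact ((k3.eventually_ne (by simp)).and (k4.eventually_ne (by simp))).and
      (((k1.eventually_const_lt (by simpa using hμ0)).and
        (k1.eventually_lt_const (by simpa using hμ0))).and
       ((k2.eventually_const_lt (by simpa using hμ0)).and
        (k2.eventually_lt_const (by simpa using hμ0))))
  obtain ⟨U, hUs, hUo, hU1⟩ := eventually_nhds_iff.1 hev
  obtain ⟨⟨z2, z3⟩, hyU, hy⟩ := hdense.inter_open_nonempty U hUo ⟨_, hU1⟩
  obtain ⟨⟨n2, n3⟩, ⟨a1, a2⟩, b1, b2⟩ := hUs _ hyU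
  simp only at n2 n3 a1 a2 b1 b2
  set L : ℝ := Lofz (0, z2, z3) with hL
  have hLz : ∀ ζ, Lofz (ζ, z2, z3) = L := fun ζ => rfl
  have hLb : |L| < 2 * μ := Lofz_abs_lt μ (0, z2, z3) n2 n3 a1 a2 b1 b2
  set c : ℂ := (z2 * conj z'.2.1 * z3 * conj z'.2.2)⁻¹ * (8 * μ ^ 2 * (Real.pi : ℂ) ^ 4)⁻¹ with hc
  have hc0 : c ≠ 0 := by
    have e1 : conj z'.2.1 ≠ 0 := by simpa using hz2
    have e2 : conj z'.2.2 ≠ 0 := by simpa using hz3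
    rw [hc]
    refine mul_ne_zero (inv_ne_zero ?_) (inv_ne_zero ?_)
    · exact mul_ne_zero (mul_ne_zero (mul_ne_zero n2 e1) n3) e2
    · simp [hμc]
  have hH := (isOpen_half L).measurableSet
  refine slice_false μ L hμ hLb (ellfun z') hw' m s hms c hc0 ?_
  rw [← integrable_indicator_iff hH]
  refine Integrable.congr hy (Filter.Eventually.of_forall fun ζ => ?_)
  by_cases hζ : 0 < (ζ * cexp (-(I * L))).re
  · have m1 : (ζ, z2, z3) ∈ Dmod μ := ⟨n2, n3, hζ, a1, a2, b1, b2⟩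
    have m2 : ζ ∈ {ζ : ℂ | 0 < (ζ * cexp (-(I * L))).re} := hζ
    simp only [Set.indicator_of_mem m1, Set.indicator_of_mem m2]
    rw [hLz, iteratedDeriv_formula μ L hμ hLb (ellfun z') hw' c
      (fun ζ => Kker μ (ζ, z2, z3) z') (fun ζ _ => Kker_formula μ hμ z2 z3 z' ζ) m ζ hζ]
  · have m1 : (ζ, z2, z3) ∉ Dmod μ := fun hh => hζ hh.2.2.1
    have m2 : ζ ∉ {ζ : ℂ | 0 < (ζ * cexp (-(I * L))).re} := hζ
    simp only [Set.indicator_of_notMem m1, Set.indicator_of_notMem m2]
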